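/- arXiv:2312.11429 — 3 statements merged into one kernel-verified Lean document; each statement's English description precedes it below -/
import Mathlib

section
/- Let A ∈ ℝ^N and i ∈ {1,…,N} be such that |A_i| > |A_j| for all j ≠ i, let y ∈ ℝ, and let x ∈ Sol(y,A) (with m = 1). Then: if |A_i y| > λ/2 then supp(x) = {i}, and if |A_i y| ≤ λ/2 then x = 0 (so supp(x) = ∅). -/
open MeasureTheory ProbabilityTheory Filter Real Set
open scoped ENNReal NNReal

noncomputable section

/-- The LASSO objective function `‖Ax - y‖₂² + λ‖x‖₁`. -/
def lassoObj {m N : ℕ} (lam : ℝ) (y : Fin m → ℝ) (A : Matrix (Fin m) (Fin N) ℝ)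
    (x : Fin N → ℝ) : ℝ :=
  (∑ i, (A.mulVec x i - y i) ^ 2) + lam * ∑ j, |x j|

/-- The LASSO solution set `Sol(y,A)`. -/
def Sol {m N : ℕ} (lam : ℝ) (y : Fin m → ℝ) (A : Matrix (Fin m) (Fin N) ℝ) :
    Set (Fin N → ℝ) :=
  {x | ∀ z, lassoObj lam y A x ≤ lassoObj lam y A z}

/-- Support of a vector. -/
def supp {N : ℕ} (x : Fin N → ℝ) : Set (Fin N) := {i | x i ≠ 0}

/-- Stability support: distance to support change. -/
def stsp {m N : ℕ} (lam : ℝ) (y : Fin m → ℝ) (A : Matrix (Fin m) (Fin N) ℝ) : ℝ :=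
  sInf {δ : ℝ | 0 ≤ δ ∧ ∃ (y' : Fin m → ℝ) (A' : Matrix (Fin m) (Fin N) ℝ)
    (x x' : Fin N → ℝ), x ∈ Sol lam y A ∧ x' ∈ Sol lam y' A' ∧
    (∀ i, |y' i - y i| ≤ δ) ∧ (∀ i j, |A' i j - A i j| ≤ δ) ∧ supp x ≠ supp x'}

/-- The LASSO condition number `C_UL(y,A)`; it is `∞` when `stsp(y,A) = 0`. -/
def condUL {m N : ℕ} (lam : ℝ) (y : Fin m → ℝ) (A : Matrix (Fin m) (Fin N) ℝ) : ℝ≥0∞ :=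
  if stsp lam y A = 0 then ⊤ else ENNReal.ofReal (1 / stsp lam y A)

/-- `m = 1` case: identify `ℝ^{1×N}` with `ℝ^N` and `ℝ^1` with `ℝ`. -/
def Sol1 {N : ℕ} (lam : ℝ) (y : ℝ) (A : Fin N → ℝ) : Set (Fin N → ℝ) :=
  Sol lam (fun _ : Fin 1 => y) (Matrix.of fun _ j => A j)

def stsp1 {N : ℕ} (lam : ℝ) (y : ℝ) (A : Fin N → ℝ) : ℝ :=
  stsp lam (fun _ : Fin 1 => y) (Matrix.of fun _ j => A j)

theorem obj_single {N : ℕ} (lam y : ℝ) (A : Fin N → ℝ) (i : Fin N) (u : ℝ) :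
    lassoObj lam (fun _ : Fin 1 => y) (Matrix.of fun _ j => A j) (Pi.single i u)
      = (A i * u - y) ^ 2 + lam * |u| := by
  have h1 : ∑ j, |(Pi.single i u : Fin N → ℝ) j| = |u| := by
    rw [Finset.sum_eq_single i]
    · simp
    · intro j _ hj
      simp [Pi.single_eq_of_ne hj]
    · simp
  unfold lassoObj
  rw [h1]
  simp [mul_comm]

/-- If `|A_i| > |A_j|` for all `j ≠ i`, and `x ∈ Sol(y,A)` (with `m = 1`),
then `supp(x) = {i}` when `|A_i y| > λ/2`, and `x = 0` when `|A_i y| ≤ λ/2`. -/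
theorem support_of_1D_lasso_solution
    {N : ℕ} (lam : ℝ) (hlam : 0 < lam)
    (A : Fin N → ℝ) (i : Fin N) (hmax : ∀ j, j ≠ i → |A j| < |A i|)
    (y : ℝ) (x : Fin N → ℝ) (hx : x ∈ Sol1 lam y A) :
    (lam / 2 < |A i * y| → supp x = {i}) ∧
    (|A i * y| ≤ lam / 2 → x = 0) := by
  have hs : ∀ u, lassoObj lam (fun _ : Fin 1 => y) (Matrix.of fun _ j => A j) x
      ≤ (A i * u - y) ^ 2 + lam * |u| := fun u => by
    rw [← obj_single]
    exact hx _
  have h0 : ∀ j, j ≠ i → x j = 0 := by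
    intro j hj
    by_contra hne
    have ha : 0 < |A i| := (abs_nonneg _).trans_lt (hmax j hj)
    have ha' : A i ≠ 0 := abs_pos.mp ha
    have hle : |∑ k, A k * x k| < |A i| * ∑ k, |x k| := by
      rw [Finset.mul_sum]
      refine (Finset.abs_sum_le_sum_abs _ _).trans_lt ?_
      refine Finset.sum_lt_sum ?_ ⟨j, Finset.mem_univ _, ?_⟩
      · intro k _
        rw [abs_mul]
        refine mul_le_mul_of_nonneg_right ?_ (abs_nonneg _)
        by_cases hk : k = i
        · rw [hk]
        · exact (hmax k hk).le
      · rw [abs_mul]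
        exact mul_lt_mul_of_pos_right (hmax j hj) (abs_pos.mpr hne)
    have h := hs ((∑ k, A k * x k) / A i)
    rw [mul_div_cancel₀ _ ha', abs_div] at h
    have h2 : |∑ k, A k * x k| / |A i| < ∑ k, |x k| := by
      rw [div_lt_iff₀ ha]; linarith
    have h3 := mul_lt_mul_of_pos_left h2 hlam
    simp only [lassoObj, Matrix.mulVec, dotProduct, Matrix.of_apply,
      Finset.univ_unique, Finset.sum_singleton] at h
    linarith
  have hxe : x = Pi.single i (x i) := by
    funext j
    by_cases hj : j = i
    · subst hj; simp
    · rw [h0 j hj, Pi.single_eq_of_ne hj]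
  have hs' : ∀ u, (A i * x i - y) ^ 2 + lam * |x i| ≤ (A i * u - y) ^ 2 + lam * |u| := by
    intro u
    rw [← obj_single lam y A i (x i), ← hxe]
    exact hs u
  constructor
  · intro hay
    have hxi : x i ≠ 0 := by
      intro hz
      have ha : A i ≠ 0 := by
        intro h
        rw [h] at hay
        simp at hay
        linarith
      have ha2 : 0 < (A i) ^ 2 := by positivity
      rw [hz] at hs'
      simp only [mul_zero, abs_zero, add_zero, zero_sub] at hs'
      have key : ∀ c : ℝ, 0 < c → |A i * y| = c + lam / 2 → False := by
        intro c hc hcy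
        have hv : 0 < c / A i ^ 2 := by positivity
        have hvc : A i ^ 2 * (c / A i ^ 2) = c := by field_simp
        generalize c / A i ^ 2 = v at hv hvc
        have hcv := mul_pos hc hv
        rcases abs_cases (A i * y) with ⟨h1, _⟩ | ⟨h1, _⟩
        · have h := hs' v
          rw [abs_of_pos hv] at h
          have e1 : A i * y = c + lam / 2 := by linarith
          have e : (A i * v - y) ^ 2 = (A i ^ 2 * v) * v - 2 * (A i * y) * v + y ^ 2 := by ring
          rw [e, hvc, e1] at h
          nlinarith
        · have h := hs' (-v)
          rw [abs_neg, abs_of_pos hv] at h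
          have e1 : A i * y = -(c + lam / 2) := by linarith
          have e : (A i * -v - y) ^ 2 = (A i ^ 2 * v) * v + 2 * (A i * y) * v + y ^ 2 := by ring
          rw [e, hvc, e1] at h
          nlinarith
      exact key (|A i * y| - lam / 2) (by linarith) (by ring)
    ext j
    simp only [supp, Set.mem_setOf_eq, Set.mem_singleton_iff]
    constructor
    · intro h
      by_contra hj
      exact h (h0 j hj)
    · rintro rfl
      exact hxi
  · intro hay
    have h := hs' 0
    simp only [mul_zero, abs_zero, add_zero, zero_sub] at h
    have h1 : A i * y * x i ≤ lam / 2 * |x i| := by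
      refine (le_abs_self _).trans ?_
      rw [abs_mul]
      exact mul_le_mul_of_nonneg_right hay (abs_nonneg _)
    have h2 : (A i * x i) ^ 2 ≤ 0 := by nlinarith
    have h3 : A i * x i = 0 := by
      have := sq_nonneg (A i * x i)
      exact pow_eq_zero_iff (two_ne_zero) |>.mp (le_antisymm h2 this)
    rw [h3] at h
    have h4 : lam * |x i| ≤ 0 := by nlinarith
    have h5 : |x i| ≤ 0 := by
      by_contra hc
      push Not at hc
      have := mul_pos hlam hc
      linarith
    rw [hxe, abs_nonpos_iff.mp h5]
    simp
end
end

section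
/- Let A ∈ ℝ^N (N ≥ 2) be randomly drawn from a distribution which is absolutely continuous with respect to the Lebesgue measure on ℝ^N, let y ∈ ℝ and ε > 0. Then ℙ[Z(y,A,ε) ∩ {stsp(y,A) < ε}] = ℙ[Z(y,A,ε) ∩ {δ(A) < 2ε}]. -/
open MeasureTheory ProbabilityTheory Filter Real Set
open scoped ENNReal NNReal

noncomputable section

/-- The event `Z(y,A,ε)`: every `ε`-perturbation `(ỹ,Ã)` of `(y,A)` (in the max norm)
has `0 ∉ Sol(ỹ,Ã)`. -/
def Zevent {N : ℕ} (lam : ℝ) (y : ℝ) (A : Fin N → ℝ) (ε : ℝ) : Prop :=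
  ∀ (y' : ℝ) (A' : Fin N → ℝ), |y' - y| ≤ ε → (∀ j, |A' j - A j| ≤ ε) →
    (0 : Fin N → ℝ) ∉ Sol1 lam y' A'

/-- `δ(A)`: the largest entry of `(|A₁|,…,|A_N|)` minus the second largest entry
(the second largest being `min_i max_{j ≠ i} |A_j|`). -/
def gap {N : ℕ} (A : Fin N → ℝ) : ℝ :=
  sSup (Set.range fun i => |A i|) -
    sInf (Set.range fun i : Fin N => sSup {v | ∃ j, j ≠ i ∧ v = |A j|})

theorem obj1 {N : ℕ} (lam y : ℝ) (a z : Fin N → ℝ) :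
    lassoObj lam (fun _ : Fin 1 => y) (Matrix.of fun _ j => a j) z =
      ((∑ j, a j * z j) - y) ^ 2 + lam * ∑ j, |z j| := by
  simp [lassoObj, Matrix.mulVec, dotProduct]

theorem mem_Sol1 {N : ℕ} (lam y : ℝ) (a x : Fin N → ℝ) :
    x ∈ Sol1 lam y a ↔ ∀ z : Fin N → ℝ, ((∑ j, a j * x j) - y) ^ 2 + lam * ∑ j, |x j| ≤
      ((∑ j, a j * z j) - y) ^ 2 + lam * ∑ j, |z j| := by
  simp only [Sol1, Sol, Set.mem_setOf_eq, obj1]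

theorem supp_max {N : ℕ} {lam y : ℝ} (hlam : 0 < lam) {a x : Fin N → ℝ}
    (hx : x ∈ Sol1 lam y a) {i : Fin N} (hi : x i ≠ 0) (j : Fin N) : |a j| ≤ |a i| := by
  by_contra! hlt
  have hj : 0 < |a j| := lt_of_le_of_lt (abs_nonneg _) hlt
  have hj0 : a j ≠ 0 := abs_pos.mp hj
  have hij : i ≠ j := by rintro rfl; exact lt_irrefl _ hlt
  rw [mem_Sol1] at hx
  set b := x i * a i / a j with hb
  have h := hx (fun k => x k + (if k = i then - x i else 0) + (if k = j then b else 0))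
  have e1 : ∑ k, a k * (x k + (if k = i then - x i else 0) + (if k = j then b else 0))
      = ∑ k, a k * x k := by
    simp only [mul_add, Finset.sum_add_distrib, mul_ite, mul_zero, Finset.sum_ite_eq',
      Finset.mem_univ, if_true]
    rw [hb]; field_simp; ring
  have e2 : ∑ k, |x k + (if k = i then - x i else 0) + (if k = j then b else 0)|
      ≤ ∑ k, (|x k| + (if k = i then - |x i| else 0) + (if k = j then |b| else 0)) := by
    apply Finset.sum_le_sum
    intro k _
    by_cases h1 : k = i
    · subst h1; simp [hij]
    · by_cases h2 : k = j
      · subst h2; simpa [h1] using abs_add_le (x k) b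
      · simp [h1, h2]
  have e3 : ∑ k, (|x k| + (if k = i then - |x i| else 0) + (if k = j then |b| else 0))
      = ∑ k, |x k| - |x i| + |b| := by
    simp only [Finset.sum_add_distrib, Finset.sum_ite_eq', Finset.mem_univ, if_true]
    ring
  have e4 : |b| < |x i| := by
    rw [hb, abs_div, abs_mul, div_lt_iff₀ hj]
    exact mul_lt_mul_of_pos_left hlt (abs_pos.mpr hi)
  rw [e1] at h
  have : lam * ∑ k, |x k| ≤ lam * ∑ k, |x k + (if k = i then - x i else 0) + (if k = j then b else 0)| := by
    linarith
  have := le_of_mul_le_mul_left this hlam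
  linarith

theorem abs_dot_le {N : ℕ} (a z : Fin N → ℝ) (i : Fin N) (hi : ∀ j, |a j| ≤ |a i|) :
    |∑ j, a j * z j| ≤ |a i| * ∑ j, |z j| := by
  refine (Finset.abs_sum_le_sum_abs _ _).trans ?_
  rw [Finset.mul_sum]
  apply Finset.sum_le_sum
  intro j _
  rw [abs_mul]
  exact mul_le_mul_of_nonneg_right (hi j) (abs_nonneg _)

theorem exists_sol {N : ℕ} {lam y : ℝ} (hlam : 0 < lam) {a : Fin N → ℝ}
    (h0 : (0 : Fin N → ℝ) ∉ Sol1 lam y a) (i : Fin N) (hi : ∀ j, |a j| ≤ |a i|) :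
    ∃ x ∈ Sol1 lam y a, supp x = {i} := by
  have hgt : lam < 2 * |y| * |a i| := by
    by_contra! hle
    apply h0
    rw [mem_Sol1]
    intro z
    have h1 := abs_dot_le a z i hi
    have h2 : 0 ≤ ∑ j, |z j| := Finset.sum_nonneg fun _ _ => abs_nonneg _
    set u := ∑ j, a j * z j
    have h3 : u * y ≤ |u| * |y| := by rw [← abs_mul]; exact le_abs_self _
    have h4 : |u| * |y| ≤ (|a i| * ∑ j, |z j|) * |y| :=
      mul_le_mul_of_nonneg_right h1 (abs_nonneg _)
    have h6 : 0 ≤ (2 * |y| * |a i|) * ∑ j, |z j| := by positivity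
    have key : 2 * (u * y) ≤ u ^ 2 + lam * ∑ j, |z j| := by
      have h5 : (2 * |y| * |a i|) * ∑ j, |z j| ≤ lam * ∑ j, |z j| :=
        mul_le_mul_of_nonneg_right hle h2
      nlinarith [sq_nonneg u]
    simp only [Pi.zero_apply, mul_zero, Finset.sum_const_zero, abs_zero]
    nlinarith
  have hai : 0 < |a i| := by
    by_contra! h
    have : |a i| = 0 := le_antisymm h (abs_nonneg _)
    rw [this] at hgt; linarith
  have hai0 : a i ≠ 0 := abs_pos.mp hai
  set c := lam / |a i| with hc
  have hc0 : 0 < c := div_pos hlam hai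
  have hcy : c < 2 * |y| := by rw [hc, div_lt_iff₀ hai]; exact hgt
  have hcl : lam = c * |a i| := by rw [hc]; field_simp
  obtain ⟨s, hs0, hs⟩ : ∃ s : ℝ, s ≠ 0 ∧ ∀ u : ℝ, (s - y) ^ 2 + c * |s| ≤ (u - y) ^ 2 + c * |u| := by
    rcases le_total 0 y with hy | hy
    · rw [abs_of_nonneg hy] at hcy
      refine ⟨y - c / 2, by intro h; linarith, fun u => ?_⟩
      rw [abs_of_pos (by linarith : 0 < y - c / 2)]
      nlinarith [le_abs_self u, sq_nonneg (u - (y - c / 2))]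
    · rw [abs_of_nonpos hy] at hcy
      refine ⟨y + c / 2, by intro h; linarith, fun u => ?_⟩
      rw [abs_of_neg (by linarith : y + c / 2 < 0)]
      nlinarith [neg_abs_le u, sq_nonneg (u - (y + c / 2))]
  refine ⟨fun k => if k = i then s / a i else 0, ?_, ?_⟩
  · rw [mem_Sol1]
    intro z
    have e1 : ∑ j, a j * (if j = i then s / a i else 0) = s := by
      simp only [mul_ite, mul_zero, Finset.sum_ite_eq', Finset.mem_univ, if_true]
      field_simp
    have e2 : ∑ j, |(if j = i then s / a i else 0)| = |s| / |a i| := by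
      simp only [apply_ite abs, abs_zero, Finset.sum_ite_eq', Finset.mem_univ, if_true, abs_div]
    rw [e1, e2]
    have e3 : lam * (|s| / |a i|) = c * |s| := by rw [hc]; ring
    rw [e3]
    refine (hs (∑ j, a j * z j)).trans ?_
    have h1 := mul_le_mul_of_nonneg_left (abs_dot_le a z i hi) hc0.le
    rw [← mul_assoc, ← hcl] at h1
    linarith
  · ext k
    simp [supp, hs0, hai0]

theorem gap_spec {N : ℕ} (hN : 2 ≤ N) (a : Fin N → ℝ) :
    ∃ i j : Fin N, i ≠ j ∧ (∀ k, |a k| ≤ |a i|) ∧ (∀ k, k ≠ i → |a k| ≤ |a j|) ∧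
      gap a = |a i| - |a j| := by
  haveI : Nontrivial (Fin N) := Fin.nontrivial_iff_two_le.mpr hN
  obtain ⟨i, hi⟩ := Finite.exists_max (fun k => |a k|)
  obtain ⟨l, hl⟩ := exists_ne i
  obtain ⟨j, hj, hjm⟩ := Finset.exists_max_image (Finset.univ.erase i) (fun k => |a k|)
    ⟨l, by simp [hl]⟩
  have hji : j ≠ i := by simpa using hj
  have hjm' : ∀ k, k ≠ i → |a k| ≤ |a j| := fun k hk => hjm k (by simp [hk])
  refine ⟨i, j, hji.symm, hi, hjm', ?_⟩
  have h1 : IsGreatest (Set.range fun i => |a i|) |a i| :=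
    ⟨⟨i, rfl⟩, by rintro _ ⟨k, rfl⟩; exact hi k⟩
  have h2 : IsGreatest {v | ∃ k, k ≠ i ∧ v = |a k|} |a j| :=
    ⟨⟨j, hji, rfl⟩, by rintro _ ⟨k, hk, rfl⟩; exact hjm' k hk⟩
  have h3 : IsLeast (Set.range fun i : Fin N => sSup {v | ∃ j, j ≠ i ∧ v = |a j|}) |a j| := by
    refine ⟨⟨i, h2.csSup_eq⟩, ?_⟩
    rintro _ ⟨k, rfl⟩
    have hb : BddAbove {v | ∃ j, j ≠ k ∧ v = |a j|} :=
      ⟨|a i|, by rintro _ ⟨k, _, rfl⟩; exact hi k⟩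
    by_cases hk : k = j
    · exact (hi j).trans (le_csSup hb ⟨i, by rw [hk]; exact hji.symm, rfl⟩)
    · exact le_csSup hb ⟨j, fun h => hk h.symm, rfl⟩
  rw [gap, h1.csSup_eq, h3.csInf_eq]

theorem shift_abs (b d : ℝ) (h : 0 ≤ |b| + d) : ∃ b', |b' - b| ≤ |d| ∧ |b'| = |b| + d := by
  rcases le_total 0 b with hb | hb
  · rw [abs_of_nonneg hb] at *
    exact ⟨b + d, by simp, abs_of_nonneg h⟩
  · rw [abs_of_nonpos hb] at *
    refine ⟨b - d, by simp, ?_⟩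
    rw [abs_of_nonpos (by linarith)]; ring

theorem supp_eq {N : ℕ} {lam y : ℝ} (hlam : 0 < lam) {a x : Fin N → ℝ}
    (hx : x ∈ Sol1 lam y a) (h0 : (0 : Fin N → ℝ) ∉ Sol1 lam y a) (i : Fin N)
    (hi : ∀ j, j ≠ i → |a j| < |a i|) : supp x = {i} := by
  have h : ∀ k, x k ≠ 0 → k = i := by
    intro k hk
    by_contra hki
    exact absurd (supp_max hlam hx hk i) (not_le.mpr (hi k hki))
  have hne : x i ≠ 0 := by
    intro hxi
    apply h0
    have : x = 0 := by
      ext k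
      by_contra hk
      exact hk (by rw [h k hk]; exact hxi)
    rwa [← this]
  ext k
  simp only [supp, Set.mem_setOf_eq, Set.mem_singleton_iff]
  exact ⟨h k, by rintro rfl; exact hne⟩

theorem core {N : ℕ} (hN : 2 ≤ N) (lam : ℝ) (hlam : 0 < lam) (a : Fin N → ℝ)
    (y : ℝ) (ε : ℝ) (hε : 0 < ε) (hZ : Zevent lam y a ε) :
    stsp1 lam y a < ε ↔ gap a < 2 * ε := by
  obtain ⟨i, j, hij, hi, hj, hg⟩ := gap_spec hN a
  have h0 : (0 : Fin N → ℝ) ∉ Sol1 lam y a :=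
    hZ y a (by simpa using hε.le) (fun _ => by simpa using hε.le)
  obtain ⟨x, hx, hsx⟩ := exists_sol hlam h0 i hi
  have hgi := hi j
  constructor
  · intro h
    by_contra! hge
    unfold stsp1 stsp at h
    obtain ⟨δ, ⟨hδ0, y', A', x, x', hx, hx', hy, hA, hne⟩, hδ⟩ := exists_lt_of_csInf_lt (by
      refine ⟨max |y| |a i|, le_max_of_le_left (abs_nonneg _), fun _ => 0, 0, x, 0, hx, ?_, ?_, ?_, ?_⟩
      · intro z
        simp only [lassoObj]
        simp
        exact mul_nonneg hlam.le (Finset.sum_nonneg fun _ _ => abs_nonneg _)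
      · intro _; simp
      · intro _ k; simpa using Or.inr (hi k)
      · rw [hsx]
        intro hh
        have : i ∈ supp (0 : Fin N → ℝ) := by rw [← hh]; rfl
        exact this rfl) h
    have hx'' : x' ∈ Sol1 lam (y' 0) (A' 0) := by
      unfold Sol1
      convert hx' using 2
      · ext k; rw [Subsingleton.elim k 0]
      · ext k l; rw [Subsingleton.elim k 0]; rfl
    have hA' : ∀ k, |A' 0 k - a k| ≤ δ := fun k => hA 0 k
    apply hne
    rw [supp_eq hlam hx h0 i, supp_eq hlam hx'' (hZ _ _ ((hy 0).trans hδ.le)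
      fun k => (hA' k).trans hδ.le) i]
    · intro k hk
      have h1 := abs_sub_abs_le_abs_sub (A' 0 k) (a k)
      have h2 := abs_sub_abs_le_abs_sub (a i) (A' 0 i)
      rw [abs_sub_comm] at h2
      have := hj k hk
      have := hA' k
      have := hA' i
      linarith
    · intro k hk
      have := hj k hk
      linarith
  · intro h
    set g := gap a / 2 with hgdef
    have hg0 : 0 ≤ g := by rw [hgdef, hg]; linarith
    have hjn := abs_nonneg (a j)
    obtain ⟨b, hb1, hb2⟩ := shift_abs (a i) (-g) (by linarith)
    obtain ⟨c, hc1, hc2⟩ := shift_abs (a j) g (by linarith)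
    rw [abs_neg] at hb1
    rw [abs_of_nonneg hg0] at hb1 hc1
    set a' : Fin N → ℝ := fun k => if k = i then b else if k = j then c else a k with ha'
    have hai : a' i = b := by simp [ha']
    have haj : a' j = c := by simp [ha', hij.symm]
    have hd : ∀ k, |a' k - a k| ≤ g := by
      intro k
      by_cases h1 : k = i
      · rw [h1, hai]; exact hb1
      · by_cases h2 : k = j
        · rw [h2, haj]; exact hc1
        · simp [ha', h1, h2, hg0]
    have hbc : |b| = |c| := by linarith
    have hm : ∀ k, |a' k| ≤ |c| := by
      intro k
      by_cases h1 : k = i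
      · rw [h1, hai, hbc]
      · by_cases h2 : k = j
        · rw [h2, haj]
        · have := hj k h1
          simp only [ha', h1, h2, if_false]
          linarith
    have h0' : (0 : Fin N → ℝ) ∉ Sol1 lam y a' :=
      hZ y a' (by simpa using hε.le) (fun k => (hd k).trans (by linarith))
    obtain ⟨x', hx', hs'⟩ := exists_sol hlam h0' j (by rw [haj]; exact hm)
    refine lt_of_le_of_lt (b := g) ?_ (by linarith)
    apply csInf_le
    · exact ⟨0, fun _ h => h.1⟩
    · refine ⟨hg0, fun _ => y, Matrix.of fun _ k => a' k, x, x', hx, hx', ?_, ?_, ?_⟩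
      · intro _; simpa using hg0
      · intro _ k; exact hd k
      · rw [hsx, hs']
        simpa using hij

/-- If `A ∈ ℝ^N` (`N ≥ 2`) has a law absolutely continuous w.r.t. Lebesgue
measure on `ℝ^N`, then for all `y ∈ ℝ` and `ε > 0`,
`ℙ[Z(y,A,ε) ∩ {stsp(y,A) < ε}] = ℙ[Z(y,A,ε) ∩ {δ(A) < 2ε}]`. -/
theorem Z_and_gap_condition_relation
    {N : ℕ} (hN : 2 ≤ N) (lam : ℝ) (hlam : 0 < lam)
    (Ω : Type) [MeasurableSpace Ω] (μ : Measure Ω) [IsProbabilityMeasure μ]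
    (A : Ω → Fin N → ℝ) (hmeas : Measurable A)
    (hac : Measure.map A μ ≪ (volume : Measure (Fin N → ℝ)))
    (y : ℝ) (ε : ℝ) (hε : 0 < ε) :
    μ ({ω | Zevent lam y (A ω) ε} ∩ {ω | stsp1 lam y (A ω) < ε}) =
      μ ({ω | Zevent lam y (A ω) ε} ∩ {ω | gap (A ω) < 2 * ε}) := by
  congr 1
  ext ω
  simp only [Set.mem_inter_iff, Set.mem_setOf_eq]
  exact and_congr_right fun hZ => core hN lam hlam (A ω) y ε hε hZ
end
end

section
/- For every (y,A) ∈ ℝ^m × ℝ^{m×N}, writing α = ⦀(y,A)⦀₂ and σ = σ(y,A), the stability support satisfies stsp(y,A) ≥ (mN)^{−1/2} · min{ σ²/q(α,σ), √σ/(6α), α }. -/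
open MeasureTheory ProbabilityTheory Filter Real Set
open scoped ENNReal NNReal

noncomputable section

/-- Euclidean norm on `ℝ^k`. -/
def l2norm {k : ℕ} (x : Fin k → ℝ) : ℝ := Real.sqrt (∑ i, x i ^ 2)

/-- Spectral norm (operator `2`-norm) of a matrix. -/
def specNorm {m N : ℕ} (A : Matrix (Fin m) (Fin N) ℝ) : ℝ :=
  sSup {v | ∃ x : Fin N → ℝ, l2norm x ≤ 1 ∧ v = l2norm (A.mulVec x)}

/-- The truncated norm `⦀(y,A)⦀₂ = max{‖A‖₂, ‖y‖₂, 1}`. -/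
def trNorm2 {m N : ℕ} (y : Fin m → ℝ) (A : Matrix (Fin m) (Fin N) ℝ) : ℝ :=
  max (specNorm A) (max (l2norm y) 1)

/-- The polynomial `q(ν,ξ) = 96ν⁵ + 12ν³(1 + λ√N)√ξ + ξ(2ν³/λ + 3ν)`. -/
def qpoly (N : ℕ) (lam ν ξ : ℝ) : ℝ :=
  96 * ν ^ 5 + 12 * ν ^ 3 * (1 + lam * Real.sqrt N) * Real.sqrt ξ +
    ξ * (2 * ν ^ 3 / lam + 3 * ν)

/-- `‖A_{Sᶜ}ᵀ(Ax − y)‖_∞` where `S = supp x` (equal to `0` when `Sᶜ = ∅`). -/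
def dualInfNorm {m N : ℕ} (y : Fin m → ℝ) (A : Matrix (Fin m) (Fin N) ℝ)
    (x : Fin N → ℝ) : ℝ :=
  sSup {v | ∃ j, j ∉ supp x ∧ v = |∑ i, A i j * (A.mulVec x i - y i)|}

/-- `σ₁(y,A) = inf{λ/2 − ‖A_{Sᶜ}ᵀ(Ax − y)‖_∞ : x ∈ Sol(y,A), S = supp x}` (in `[0,∞]`,
with `inf ∅ = ∞`). -/
def sigma1 {m N : ℕ} (lam : ℝ) (y : Fin m → ℝ) (A : Matrix (Fin m) (Fin N) ℝ) : ℝ≥0∞ :=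
  sInf {t | ∃ x ∈ Sol lam y A, t = ENNReal.ofReal (lam / 2 - dualInfNorm y A x)}

open scoped Classical in
/-- `‖(A_Sᵀ A_S)^{−1}‖₂^{−1}`, i.e. the smallest eigenvalue of the Gram matrix `A_Sᵀ A_S`
(`0` when the Gram matrix is singular, `∞` when `S = ∅`). -/
def gramInvNormInv {m N : ℕ} (A : Matrix (Fin m) (Fin N) ℝ) (S : Set (Fin N)) : ℝ≥0∞ :=
  if S = ∅ then ⊤ else
    ENNReal.ofReal (sInf {v | ∃ z : Fin N → ℝ, (∀ j, j ∉ S → z j = 0) ∧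
      (∑ j, z j ^ 2) = 1 ∧ v = ∑ i, (A.mulVec z i) ^ 2})

/-- `σ₂(y,A)`. -/
def sigma2 {m N : ℕ} (lam : ℝ) (y : Fin m → ℝ) (A : Matrix (Fin m) (Fin N) ℝ) : ℝ≥0∞ :=
  sInf {t | ∃ x ∈ Sol lam y A, t = gramInvNormInv A (supp x)}

/-- `σ₃(y,A) = inf{|x_i| : x ∈ Sol(y,A), x_i ≠ 0}` (with `inf ∅ = ∞`). -/
def sigma3 {m N : ℕ} (lam : ℝ) (y : Fin m → ℝ) (A : Matrix (Fin m) (Fin N) ℝ) : ℝ≥0∞ :=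
  sInf {t | ∃ (i : Fin N) (x : Fin N → ℝ), x ∈ Sol lam y A ∧ x i ≠ 0 ∧
    t = ENNReal.ofReal |x i|}

/-- `σ(y,A) = min{σ₁(y,A), σ₂(y,A)², σ₃(y,A)}`. -/
def sigmaUL {m N : ℕ} (lam : ℝ) (y : Fin m → ℝ) (A : Matrix (Fin m) (Fin N) ℝ) : ℝ≥0∞ :=
  min (sigma1 lam y A) (min ((sigma2 lam y A) ^ 2) (sigma3 lam y A))

lemma le_sq_aux {a b : ℝ} (h : a ^ 2 ≤ b ^ 2) (hb : 0 ≤ b) : a ≤ b := (le_abs_self a).trans (abs_le_of_sq_le_sq h hb)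

set_option maxHeartbeats 1000000 in
lemma core_s10 {E F : Type*} [NormedAddCommGroup E] [InnerProductSpace ℝ E]
    [NormedAddCommGroup F] [InnerProductSpace ℝ F] (T T' : E →ₗ[ℝ] F) (x h : E) (y y' : F)
    (α d r : ℝ) (hr : 0 < r) (hα : 1 ≤ α) (hrα : r ≤ α) (hd0 : 0 ≤ d)
    (hd1 : d ≤ r ^ 2 / (6 * α)) (hd2 : d * (96 * α ^ 5) < r ^ 8)
    (hT : ∀ u, ‖T u‖ ≤ α * ‖u‖) (hTT : ∀ u, ‖T' u - T u‖ ≤ d * ‖u‖)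
    (hy : ‖y‖ ≤ α) (hyy : ‖y' - y‖ ≤ d) (hres : ‖T x - y‖ ≤ α)
    (hx : r * ‖x‖ ≤ ‖T x‖) (hh : r * ‖h‖ ≤ ‖T h‖)
    (hVI : inner ℝ (T' (x + h) - y') (T' h) ≤ inner ℝ (T x - y) (T h)) :
    ‖h‖ < r ^ 4 ∧ ∀ u, ‖u‖ ≤ 1 →
      |inner ℝ (T' (x + h) - y') (T' u) - inner ℝ (T x - y) (T u)| < r ^ 4 := by
  have hα0 : 0 < α := by linarith
  have hdr : 6 * d ≤ r := by
    rw [le_div_iff₀ (by positivity)] at hd1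
    by_contra hc
    push Not at hc
    nlinarith
  have hdα : d ≤ α := by linarith
  have hT' : ∀ u, ‖T' u‖ ≤ 2 * α * ‖u‖ := fun u => by
    have h1 := norm_add_le (T' u - T u) (T u)
    rw [sub_add_cancel] at h1
    nlinarith [hT u, hTT u, norm_nonneg u]
  -- `r * ‖x‖ ≤ 2 α`
  have hx2 : r * ‖x‖ ≤ 2 * α := by
    have h1 := norm_add_le (T x - y) y
    rw [sub_add_cancel] at h1
    linarith
  set e : ℝ := 7 * α ^ 2 * d / r with he
  have he0 : 0 ≤ e := by positivity
  have hE : ∀ u, |inner ℝ (T' x - y') (T' u) - inner ℝ (T x - y) (T u)| ≤ e * ‖u‖ := fun u => by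
    have h1 : inner ℝ (T' x - y') (T' u) - inner ℝ (T x - y) (T u)
        = inner ℝ ((T' x - T x) - (y' - y)) (T' u) + inner ℝ (T x - y) (T' u - T u) := by
      simp only [inner_sub_left, inner_sub_right]; ring
    rw [h1]
    have h2 := abs_real_inner_le_norm ((T' x - T x) - (y' - y)) (T' u)
    have h3 := abs_real_inner_le_norm (T x - y) (T' u - T u)
    have h4 : ‖(T' x - T x) - (y' - y)‖ ≤ d * ‖x‖ + d :=
      (norm_sub_le _ _).trans (add_le_add (hTT x) hyy)
    have h5 : ‖(T' x - T x) - (y' - y)‖ * ‖T' u‖ ≤ (d * ‖x‖ + d) * (2 * α * ‖u‖) :=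
      mul_le_mul h4 (hT' u) (norm_nonneg _) (by positivity)
    have h6 : ‖T x - y‖ * ‖T' u - T u‖ ≤ α * (d * ‖u‖) :=
      mul_le_mul hres (hTT u) (norm_nonneg _) hα0.le
    have h7 : (d * ‖x‖ + d) * (2 * α) + α * d ≤ e := by
      rw [he, le_div_iff₀ hr]
      have a1 : d * (2 * α) * (r * ‖x‖) ≤ d * (2 * α) * (2 * α) :=
        mul_le_mul_of_nonneg_left hx2 (by positivity)
      have a2 : 3 * α * d * r ≤ 3 * α * d * α := mul_le_mul_of_nonneg_left hrα (by positivity)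
      nlinarith
    calc _ ≤ _ := abs_add_le _ _
      _ ≤ ((d * ‖x‖ + d) * (2 * α) + α * d) * ‖u‖ := by linarith
      _ ≤ _ := mul_le_mul_of_nonneg_right h7 (norm_nonneg _)
  have hsplit : ∀ u, inner ℝ (T' (x + h) - y') (T' u) =
      inner ℝ (T' x - y') (T' u) + inner ℝ (T' h) (T' u) := fun u => by
    rw [map_add, ← inner_add_left]; congr 1; abel
  have hsq : ‖T' h‖ ^ 2 ≤ e * ‖h‖ := by
    have h1 := hE h
    rw [hsplit, real_inner_self_eq_norm_sq] at hVI
    have := (abs_le.1 h1).1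
    linarith
  have hlow : 5 * r * ‖h‖ ≤ 6 * ‖T' h‖ := by
    have h1 := norm_sub_le (T' h) (T' h - T h)
    rw [sub_sub_cancel] at h1
    have h2 := hTT h
    nlinarith [norm_nonneg h]
  -- main bounds
  have hA : r * ‖T' h‖ ≤ 6 / 5 * e := by
    rcases (norm_nonneg (T' h)).eq_or_lt with h0 | h0
    · rw [← h0, mul_zero]; positivity
    · have : r * ‖T' h‖ * ‖T' h‖ ≤ 6 / 5 * e * ‖T' h‖ := by nlinarith
      exact le_of_mul_le_mul_right this h0
  have hB : r ^ 2 * ‖h‖ ≤ 36 / 25 * e := by nlinarith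
  have her : e * r = 7 * α ^ 2 * d := by rw [he]; field_simp
  have hpow : ∀ k : ℕ, k ≤ 5 → α ^ k ≤ α ^ 5 := fun k hk => pow_le_pow_right₀ hα hk
  have hdα5 : 0 ≤ d * α ^ 5 := by positivity
  refine ⟨?_, fun u hu => ?_⟩
  · have h1 : r ^ 4 * ‖h‖ ≤ 36 / 25 * (7 * α ^ 2 * d) * r := by
      have := mul_le_mul_of_nonneg_right hB (sq_nonneg r)
      nlinarith
    have h2 : α ^ 2 * d * r ≤ d * α ^ 5 := by
      have : d * α ^ 2 * r ≤ d * α ^ 2 * α := mul_le_mul_of_nonneg_left hrα (by positivity)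
      have h3 : d * α ^ 3 ≤ d * α ^ 5 := mul_le_mul_of_nonneg_left (hpow 3 (by norm_num)) hd0
      nlinarith
    have h4 : r ^ 4 * ‖h‖ < r ^ 4 * r ^ 4 := by
      have : r ^ 4 * r ^ 4 = r ^ 8 := by ring
      nlinarith
    exact lt_of_mul_lt_mul_left h4 (by positivity)
  · have h1 : |inner ℝ (T' (x + h) - y') (T' u) - inner ℝ (T x - y) (T u)|
        ≤ e + 2 * α * ‖T' h‖ := by
      rw [hsplit]
      have a1 := hE u
      have a2 := abs_real_inner_le_norm (T' h) (T' u)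
      have a3 : ‖T' h‖ * ‖T' u‖ ≤ ‖T' h‖ * (2 * α) :=
        mul_le_mul_of_nonneg_left ((hT' u).trans (by nlinarith)) (norm_nonneg _)
      have a4 : e * ‖u‖ ≤ e := by nlinarith
      have a5 : ∀ p q s : ℝ, |p + q - s| ≤ |p - s| + |q| := fun p q s => by
        have := abs_add_le (p - s) q
        rwa [show p - s + q = p + q - s by ring] at this
      have := a5 (inner ℝ (T' x - y') (T' u)) (inner ℝ (T' h) (T' u)) (inner ℝ (T x - y) (T u))
      linarith
    have h2 : (e + 2 * α * ‖T' h‖) * r ≤ 17 / 5 * α * e := by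
      have b1 := mul_le_mul_of_nonneg_left hrα he0
      have b2 := mul_le_mul_of_nonneg_left hA (show 0 ≤ 2 * α by positivity)
      calc _ = e * r + 2 * α * (r * ‖T' h‖) := by ring
        _ ≤ e * α + 2 * α * (6 / 5 * e) := add_le_add b1 b2
        _ = _ := by ring
    have h3 : (e + 2 * α * ‖T' h‖) * r ^ 4 ≤ 17 / 5 * 7 * (α ^ 3 * d * r ^ 2) := by
      have := mul_le_mul_of_nonneg_right h2 (pow_nonneg hr.le 3)
      have h4 : 17 / 5 * α * e * r ^ 3 = 17 / 5 * 7 * (α ^ 3 * d * r ^ 2) := by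
        rw [show 17 / 5 * α * e * r ^ 3 = 17 / 5 * α * r ^ 2 * (e * r) by ring, her]; ring
      rw [← h4]
      calc _ = (e + 2 * α * ‖T' h‖) * r * r ^ 3 := by ring
        _ ≤ _ := this
    have h5 : α ^ 3 * d * r ^ 2 ≤ d * α ^ 5 := by
      have : r ^ 2 ≤ α ^ 2 := pow_le_pow_left₀ hr.le hrα 2
      have := mul_le_mul_of_nonneg_left this (show 0 ≤ α ^ 3 * d by positivity)
      calc _ ≤ _ := this
        _ = _ := by ring
    have h4 : (e + 2 * α * ‖T' h‖) * r ^ 4 < r ^ 4 * r ^ 4 := by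
      have : r ^ 4 * r ^ 4 = r ^ 8 := by ring
      rw [this]
      linarith
    exact h1.trans_lt (lt_of_mul_lt_mul_right h4 (by positivity))

lemma core0 {E F : Type*} [NormedAddCommGroup E] [InnerProductSpace ℝ E]
    [NormedAddCommGroup F] [InnerProductSpace ℝ F] (T T' : E →ₗ[ℝ] F) (y y' : F)
    (α d s : ℝ) (hα : 1 ≤ α) (hd0 : 0 ≤ d) (hdα : d ≤ α)
    (hd2 : 3 * α * d < s)
    (hT : ∀ u, ‖T u‖ ≤ α * ‖u‖) (hTT : ∀ u, ‖T' u - T u‖ ≤ d * ‖u‖)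
    (hy : ‖y‖ ≤ α) (hyy : ‖y' - y‖ ≤ d) (u : E) (hu : ‖u‖ ≤ 1) :
      |inner ℝ (T' 0 - y') (T' u) - inner ℝ (T 0 - y) (T u)| < s := by
  have h1 : inner ℝ (T' 0 - y') (T' u) - inner ℝ (T 0 - y) (T u)
      = - (inner ℝ (y' - y) (T' u) + inner ℝ y (T' u - T u)) := by
    simp only [inner_sub_left, inner_sub_right, map_zero, inner_zero_left]; ring
  rw [h1, abs_neg]
  have hT' : ‖T' u‖ ≤ 2 * α := by
    have h1 := norm_add_le (T' u - T u) (T u)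
    rw [sub_add_cancel] at h1
    nlinarith [hT u, hTT u, norm_nonneg u]
  have h2 := abs_real_inner_le_norm (y' - y) (T' u)
  have h3 := abs_real_inner_le_norm y (T' u - T u)
  have h5 : ‖y' - y‖ * ‖T' u‖ ≤ d * (2 * α) :=
      mul_le_mul hyy hT' (norm_nonneg _) (by positivity)
  have h6 : ‖y‖ * ‖T' u - T u‖ ≤ α * d :=
      mul_le_mul hy ((hTT u).trans (by nlinarith)) (norm_nonneg _) (by linarith)
  have := abs_add_le (inner ℝ (y' - y) (T' u)) (inner ℝ y (T' u - T u))
  linarith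

abbrev v2 {k : ℕ} (x : Fin k → ℝ) : EuclideanSpace ℝ (Fin k) := WithLp.toLp 2 x

abbrev TL {m N : ℕ} (A : Matrix (Fin m) (Fin N) ℝ) :
    EuclideanSpace ℝ (Fin N) →ₗ[ℝ] EuclideanSpace ℝ (Fin m) := Matrix.toEuclideanLin A

def gr {m N : ℕ} (y : Fin m → ℝ) (A : Matrix (Fin m) (Fin N) ℝ) (x : Fin N → ℝ) (j : Fin N) : ℝ :=
  ∑ i, A i j * (A.mulVec x i - y i)

lemma TL_v2 {m N : ℕ} (A : Matrix (Fin m) (Fin N) ℝ) (x : Fin N → ℝ) :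
    TL A (v2 x) = v2 (A.mulVec x) := rfl

lemma l2_sq {k : ℕ} (x : Fin k → ℝ) : ‖v2 x‖ ^ 2 = ∑ i, x i ^ 2 := by
  simp [EuclideanSpace.norm_sq_eq]

lemma l2_eq {k : ℕ} (x : Fin k → ℝ) : l2norm x = ‖v2 x‖ := by
  simp [EuclideanSpace.norm_eq, l2norm]

lemma obj_eq {m N : ℕ} (lam : ℝ) (y : Fin m → ℝ) (A : Matrix (Fin m) (Fin N) ℝ)
    (x : Fin N → ℝ) :
    lassoObj lam y A x = ‖TL A (v2 x) - v2 y‖ ^ 2 + lam * ∑ j, |x j| := by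
  have : TL A (v2 x) - v2 y = v2 (A.mulVec x - y) := rfl
  rw [this, l2_sq]; rfl

lemma inner_gr {m N : ℕ} (y : Fin m → ℝ) (A : Matrix (Fin m) (Fin N) ℝ)
    (x u : Fin N → ℝ) :
    inner ℝ (TL A (v2 x) - v2 y) (TL A (v2 u)) = ∑ j, u j * gr y A x j := by
  have : TL A (v2 x) - v2 y = v2 (A.mulVec x - y) := rfl
  rw [this, TL_v2, EuclideanSpace.inner_toLp_toLp]
  simp only [dotProduct, Matrix.mulVec, gr, Finset.mul_sum, Finset.sum_mul, Pi.star_apply,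
    star_trivial, Pi.sub_apply]
  rw [Finset.sum_comm]
  refine Finset.sum_congr rfl fun i _ => Finset.sum_congr rfl fun j _ => ?_
  ring

lemma frob {m N : ℕ} (B : Matrix (Fin m) (Fin N) ℝ) (δ : ℝ) (hδ : 0 ≤ δ)
    (hB : ∀ i j, |B i j| ≤ δ) (x : Fin N → ℝ) :
    ‖v2 (B.mulVec x)‖ ≤ δ * Real.sqrt (m * N) * ‖v2 x‖ := by
  apply le_sq_aux _ (by positivity)
  rw [l2_sq, mul_pow, mul_pow, Real.sq_sqrt (by positivity)]
  have h1 : ∀ i, (B.mulVec x i) ^ 2 ≤ N * δ ^ 2 * ‖v2 x‖ ^ 2 := fun i => by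
    have h2 : (∑ j, B i j * x j) ^ 2 ≤ (∑ j, B i j ^ 2) * ∑ j, x j ^ 2 :=
      Finset.sum_mul_sq_le_sq_mul_sq _ _ _
    have h3 : ∑ j, B i j ^ 2 ≤ N * δ ^ 2 := by
      calc _ ≤ ∑ _j : Fin N, δ ^ 2 := Finset.sum_le_sum fun j _ => by
            rw [← sq_abs]; exact pow_le_pow_left₀ (abs_nonneg _) (hB i j) 2
        _ = _ := by simp
    rw [l2_sq]
    exact h2.trans (mul_le_mul_of_nonneg_right h3 (Finset.sum_nonneg fun _ _ => sq_nonneg _))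
  calc _ ≤ ∑ _i : Fin m, N * δ ^ 2 * ‖v2 x‖ ^ 2 := Finset.sum_le_sum fun i _ => h1 i
    _ = _ := by simp; ring

lemma vecb {m N : ℕ} (hN : 1 ≤ N) (y : Fin m → ℝ) (δ : ℝ) (hδ : 0 ≤ δ)
    (hy : ∀ i, |y i| ≤ δ) : ‖v2 y‖ ≤ δ * Real.sqrt (m * N) := by
  apply le_sq_aux _ (by positivity)
  rw [l2_sq, mul_pow, Real.sq_sqrt (by positivity)]
  have hN' : (1 : ℝ) ≤ N := by exact_mod_cast hN
  calc _ ≤ ∑ _i : Fin m, δ ^ 2 := Finset.sum_le_sum fun i _ => by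
            rw [← sq_abs]; exact pow_le_pow_left₀ (abs_nonneg _) (hy i) 2
    _ = δ ^ 2 * (m * 1) := by simp; ring
    _ ≤ _ := by gcongr

lemma entry_bound {m N : ℕ} (B : Matrix (Fin m) (Fin N) ℝ) (i j) :
    |B i j| ≤ ∑ i, ∑ j, |B i j| :=
  (Finset.single_le_sum (f := fun j => |B i j|) (fun _ _ => abs_nonneg _)
    (Finset.mem_univ j)).trans
    (Finset.single_le_sum (f := fun i => ∑ j, |B i j|)
      (fun _ _ => Finset.sum_nonneg fun _ _ => abs_nonneg _) (Finset.mem_univ i))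

lemma spec_bound {m N : ℕ} (A : Matrix (Fin m) (Fin N) ℝ) (x : Fin N → ℝ) :
    ‖v2 (A.mulVec x)‖ ≤ specNorm A * ‖v2 x‖ := by
  have hb : BddAbove {v | ∃ x : Fin N → ℝ, l2norm x ≤ 1 ∧ v = l2norm (A.mulVec x)} := by
    have h0 : 0 ≤ ∑ i, ∑ j, |A i j| :=
      Finset.sum_nonneg fun _ _ => Finset.sum_nonneg fun _ _ => abs_nonneg _
    refine ⟨(∑ i, ∑ j, |A i j|) * Real.sqrt (m * N), ?_⟩
    rintro v ⟨z, hz, rfl⟩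
    rw [l2_eq] at hz ⊢
    refine (frob A _ h0 (entry_bound A) z).trans ?_
    exact mul_le_of_le_one_right (by positivity) hz
  rcases (norm_nonneg (v2 x)).eq_or_lt with h | h
  · have hx : v2 x = 0 := norm_eq_zero.1 h.symm
    rw [← TL_v2, hx]; simp
  · have h1 : ‖v2 (A.mulVec ((‖v2 x‖)⁻¹ • x))‖ ≤ specNorm A := by
      refine le_csSup hb ⟨(‖v2 x‖)⁻¹ • x, ?_, (l2_eq _).symm⟩
      rw [l2_eq]
      have : v2 ((‖v2 x‖)⁻¹ • x) = (‖v2 x‖)⁻¹ • v2 x := rfl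
      rw [this, norm_smul, norm_inv, norm_norm, inv_mul_cancel₀ h.ne']
    have h2 : v2 (A.mulVec ((‖v2 x‖)⁻¹ • x)) = (‖v2 x‖)⁻¹ • v2 (A.mulVec x) := by
      rw [Matrix.mulVec_smul]; rfl
    rw [h2, norm_smul, norm_inv, norm_norm, inv_mul_le_iff₀ h] at h1
    linarith

lemma sol_nonempty {m N : ℕ} (lam : ℝ) (hlam : 0 < lam) (y : Fin m → ℝ)
    (A : Matrix (Fin m) (Fin N) ℝ) : ∃ x, x ∈ Sol lam y A := by
  set R := lassoObj lam y A 0 / lam with hR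
  have hR0 : 0 ≤ R := by
    rw [hR, obj_eq]
    have : 0 ≤ ∑ j, |(0 : Fin N → ℝ) j| := Finset.sum_nonneg fun _ _ => abs_nonneg _
    positivity
  have hc : Continuous (lassoObj lam y A) := by
    unfold lassoObj Matrix.mulVec dotProduct
    fun_prop
  obtain ⟨x, hx, hmin⟩ := (isCompact_closedBall (0 : Fin N → ℝ) R).exists_isMinOn
    ⟨0, Metric.mem_closedBall_self hR0⟩ hc.continuousOn
  refine ⟨x, fun z => ?_⟩
  by_cases hz : z ∈ Metric.closedBall (0 : Fin N → ℝ) R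
  · exact hmin hz
  · have h0 : lassoObj lam y A x ≤ lassoObj lam y A 0 := hmin (Metric.mem_closedBall_self hR0)
    rw [mem_closedBall_zero_iff, pi_norm_le_iff_of_nonneg hR0] at hz
    push Not at hz
    obtain ⟨j, hj⟩ := hz
    rw [Real.norm_eq_abs, hR, div_lt_iff₀ hlam] at hj
    have h1 : |z j| ≤ ∑ j, |z j| :=
      Finset.single_le_sum (f := fun j => |z j|) (fun _ _ => abs_nonneg _) (Finset.mem_univ j)
    have h2 : lam * |z j| ≤ lassoObj lam y A z := by
      rw [obj_eq]
      nlinarith [sq_nonneg ‖TL A (v2 z) - v2 y‖]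
    linarith

lemma VI {m N : ℕ} {lam : ℝ} (hlam : 0 < lam) {y : Fin m → ℝ}
    {A : Matrix (Fin m) (Fin N) ℝ} {x : Fin N → ℝ} (hx : x ∈ Sol lam y A) (z : Fin N → ℝ) :
    0 ≤ 2 * inner ℝ (TL A (v2 x) - v2 y) (TL A (v2 (z - x)))
      + lam * (∑ j, |z j| - ∑ j, |x j|) := by
  set B := 2 * inner ℝ (TL A (v2 x) - v2 y) (TL A (v2 (z - x)))
      + lam * (∑ j, |z j| - ∑ j, |x j|) with hB
  set C := ‖TL A (v2 (z - x))‖ ^ 2 with hC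
  have hC0 : 0 ≤ C := sq_nonneg _
  have key : ∀ ε : ℝ, 0 ≤ ε → ε ≤ 1 → 0 ≤ ε * B + ε ^ 2 * C := fun ε h0 h1 => by
    have h := hx (x + ε • (z - x))
    rw [obj_eq, obj_eq] at h
    have e1 : TL A (v2 (x + ε • (z - x))) - v2 y =
        (TL A (v2 x) - v2 y) + ε • TL A (v2 (z - x)) := by
      have : v2 (x + ε • (z - x)) = v2 x + ε • v2 (z - x) := rfl
      rw [this, map_add, map_smul]; abel
    rw [e1, norm_add_sq_real, inner_smul_right, norm_smul, mul_pow, Real.norm_eq_abs, sq_abs] at h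
    have e2 : ∑ j, |(x + ε • (z - x)) j| ≤ (1 - ε) * ∑ j, |x j| + ε * ∑ j, |z j| := by
      rw [Finset.mul_sum, Finset.mul_sum, ← Finset.sum_add_distrib]
      refine Finset.sum_le_sum fun j _ => ?_
      have : (x + ε • (z - x)) j = (1 - ε) * x j + ε * z j := by simp; ring
      rw [this]
      refine (abs_add_le _ _).trans ?_
      rw [abs_mul, abs_mul, abs_of_nonneg h0, abs_of_nonneg (sub_nonneg.2 h1)]
    have e3 := mul_le_mul_of_nonneg_left e2 hlam.le
    rw [hB, hC]
    nlinarith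
  by_contra hneg
  push Not at hneg
  have hD : 0 < C + 1 - B := by linarith
  have hk := key (-B / (C + 1 - B)) (div_nonneg (by linarith) hD.le)
    ((div_le_one hD).2 (by linarith))
  set ε := -B / (C + 1 - B) with hε
  have hε0 : 0 < ε := div_pos (by linarith) hD
  have hεD : ε * (C + 1 - B) = -B := div_mul_cancel₀ _ hD.ne'
  have : 0 ≤ ε * (B + ε * C) := by linarith
  have h2 : 0 ≤ B + ε * C := nonneg_of_mul_nonneg_right this hε0
  nlinarith

lemma VIc {m N : ℕ} {lam : ℝ} (hlam : 0 < lam) {y : Fin m → ℝ}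
    {A : Matrix (Fin m) (Fin N) ℝ} {x : Fin N → ℝ} (hx : x ∈ Sol lam y A) (j : Fin N) (t : ℝ) :
    0 ≤ 2 * ((t - x j) * gr y A x j) + lam * (|t| - |x j|) := by
  have h := VI hlam hx (Function.update x j t)
  rw [inner_gr, ← Finset.sum_sub_distrib] at h
  rw [Finset.sum_eq_single j, Finset.sum_eq_single j] at h
  · simpa using h
  · intro b _ hb; simp [hb]
  · simp
  · intro b _ hb; simp [hb]
  · simp

lemma uniq {m N : ℕ} {lam : ℝ} {y : Fin m → ℝ}
    {A : Matrix (Fin m) (Fin N) ℝ} {w x : Fin N → ℝ} (S : Set (Fin N))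
    (hw : ∀ j ∈ S, ∀ t, 0 ≤ 2 * ((t - w j) * gr y A w j) + lam * (|t| - |w j|))
    (hwS : ∀ j, j ∉ S → w j = 0) (hg : ∀ j, j ∉ S → |gr y A w j| < lam / 2)
    (hx : x ∈ Sol lam y A) : (∀ j, j ∉ S → x j = 0) ∧ ‖v2 (A.mulVec (x - w))‖ = 0 := by
  have h := hx w
  rw [obj_eq, obj_eq] at h
  have e1 : TL A (v2 x) - v2 y = (TL A (v2 w) - v2 y) + TL A (v2 (x - w)) := by
    have : v2 (x - w) = v2 x - v2 w := rfl
    rw [this, map_sub]; abel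
  rw [e1, norm_add_sq_real, inner_gr] at h
  have hS : ∀ j, j ∉ S → (lam - 2 * |gr y A w j|) * |x j| ≤
      2 * ((x j - w j) * gr y A w j) + lam * (|x j| - |w j|) := fun j hj => by
    rw [hwS j hj]
    have := neg_abs_le (x j * gr y A w j)
    rw [abs_mul] at this
    simp only [sub_zero, abs_zero]
    linarith
  have hnn : ∀ j, 0 ≤ 2 * ((x j - w j) * gr y A w j) + lam * (|x j| - |w j|) := fun j => by
    by_cases hj : j ∈ S
    · exact hw j hj _
    · exact (mul_nonneg (by linarith [hg j hj]) (abs_nonneg _)).trans (hS j hj)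
  have hsum : ∑ j, (2 * ((x j - w j) * gr y A w j) + lam * (|x j| - |w j|)) =
      2 * ∑ j, (x - w) j * gr y A w j + lam * (∑ j, |x j| - ∑ j, |w j|) := by
    rw [Finset.sum_add_distrib, ← Finset.mul_sum, ← Finset.mul_sum, Finset.sum_sub_distrib]
    rfl
  have hsn := Finset.sum_nonneg fun j (_ : j ∈ Finset.univ) => hnn j
  have hT0 : ‖TL A (v2 (x - w))‖ ^ 2 = 0 := by
    nlinarith [sq_nonneg ‖TL A (v2 (x - w))‖]
  have hz : ∑ j, (2 * ((x j - w j) * gr y A w j) + lam * (|x j| - |w j|)) = 0 := by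
    nlinarith [sq_nonneg ‖TL A (v2 (x - w))‖]
  refine ⟨fun j hj => ?_, pow_eq_zero_iff two_ne_zero |>.1 hT0⟩
  have h0 := (Finset.sum_eq_zero_iff_of_nonneg fun j _ => hnn j).1 hz j (Finset.mem_univ j)
  have h1 := hS j hj
  rw [h0] at h1
  have h2 : 0 < lam - 2 * |gr y A w j| := by linarith [hg j hj]
  have h3 : |x j| ≤ 0 := by
    by_contra hc
    push Not at hc
    nlinarith [mul_pos h2 hc]
  exact abs_eq_zero.1 (le_antisymm h3 (abs_nonneg _))

lemma set_nonempty {m N : ℕ} (hm : 1 ≤ m) (hN : 1 ≤ N) (lam : ℝ) (hlam : 0 < lam)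
    (y : Fin m → ℝ) (A : Matrix (Fin m) (Fin N) ℝ) :
    {δ : ℝ | 0 ≤ δ ∧ ∃ (y' : Fin m → ℝ) (A' : Matrix (Fin m) (Fin N) ℝ)
    (x x' : Fin N → ℝ), x ∈ Sol lam y A ∧ x' ∈ Sol lam y' A' ∧
    (∀ i, |y' i - y i| ≤ δ) ∧ (∀ i j, |A' i j - A i j| ≤ δ) ∧ supp x ≠ supp x'}.Nonempty := by
  obtain ⟨x, hx⟩ := sol_nonempty lam hlam y A
  suffices h : ∃ (y' : Fin m → ℝ) (A' : Matrix (Fin m) (Fin N) ℝ) (x' : Fin N → ℝ),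
      x' ∈ Sol lam y' A' ∧ supp x ≠ supp x' by
    obtain ⟨y', A', x', hx', hne⟩ := h
    have p1 : 0 ≤ ∑ i, |y' i - y i| := Finset.sum_nonneg fun _ _ => abs_nonneg _
    have p2 : 0 ≤ ∑ i, ∑ j, |(A' - A) i j| :=
      Finset.sum_nonneg fun _ _ => Finset.sum_nonneg fun _ _ => abs_nonneg _
    refine ⟨∑ i, |y' i - y i| + ∑ i, ∑ j, |(A' - A) i j|, by positivity, y', A', x, x', hx, hx',
      fun i => ?_, fun i j => ?_, hne⟩
    · have := Finset.single_le_sum (f := fun i => |y' i - y i|) (fun _ _ => abs_nonneg _)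
        (Finset.mem_univ i)
      linarith
    · have := entry_bound (A' - A) i j
      rw [Matrix.sub_apply] at this
      linarith
  by_cases hs : supp x = ∅
  · let A' : Matrix (Fin m) (Fin N) ℝ := fun _ _ => 1
    let y' : Fin m → ℝ := fun _ => lam + 1
    obtain ⟨x', hx'⟩ := sol_nonempty lam hlam y' A'
    refine ⟨y', A', x', hx', fun he => ?_⟩
    rw [hs] at he
    have hx0 : x' = 0 := by
      funext j
      by_contra hj
      have : j ∈ supp x' := hj
      rw [← he] at this
      exact this
    have hm' : (1 : ℝ) ≤ m := by exact_mod_cast hm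
    have h := hx' (Pi.single ⟨0, hN⟩ 1)
    rw [hx0] at h
    simp only [lassoObj, Matrix.mulVec_zero, Matrix.mulVec_single_one] at h
    have hcol : ∀ i, A'.col ⟨0, hN⟩ i = 1 := fun _ => rfl
    simp only [hcol] at h
    simp [y', Pi.single_apply, apply_ite] at h
    nlinarith
  · refine ⟨0, 0, 0, fun z => ?_, fun he => hs ?_⟩
    · simp only [lassoObj]
      have : 0 ≤ ∑ j, |z j| := Finset.sum_nonneg fun _ _ => abs_nonneg _
      simp
      positivity
    · rw [he]; ext j; simp [supp]

lemma gram_le {m N : ℕ} (A : Matrix (Fin m) (Fin N) ℝ) (S : Set (Fin N)) (hS : S ≠ ∅) (r : ℝ)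
    (hr : 0 < r) (h : ENNReal.ofReal (r ^ 4) ≤ gramInvNormInv A S ^ 2)
    (z : Fin N → ℝ) (hz : ∀ j, j ∉ S → z j = 0) : r * ‖v2 z‖ ≤ ‖v2 (A.mulVec z)‖ := by
  rw [gramInvNormInv, if_neg hS] at h
  set V := {v | ∃ z : Fin N → ℝ, (∀ j, j ∉ S → z j = 0) ∧
      (∑ j, z j ^ 2) = 1 ∧ v = ∑ i, (A.mulVec z i) ^ 2} with hV
  have hb : BddBelow V := ⟨0, by
    rintro v ⟨z, _, _, rfl⟩
    exact Finset.sum_nonneg fun _ _ => sq_nonneg _⟩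
  have hI0 : 0 ≤ sInf V := Real.sInf_nonneg (by
    rintro v ⟨z, _, _, rfl⟩
    exact Finset.sum_nonneg fun _ _ => sq_nonneg _)
  have h1 : r ^ 2 ≤ sInf V := by
    rw [← ENNReal.ofReal_pow hI0, ENNReal.ofReal_le_ofReal_iff (by positivity)] at h
    apply le_sq_aux _ hI0
    linarith
  rcases (norm_nonneg (v2 z)).eq_or_lt with h0 | h0
  · rw [← h0]; simp
  · have h2 : sInf V ≤ ‖v2 (A.mulVec ((‖v2 z‖)⁻¹ • z))‖ ^ 2 := by
      refine csInf_le hb ⟨(‖v2 z‖)⁻¹ • z, fun j hj => by simp [hz j hj], ?_, l2_sq _⟩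
      rw [← l2_sq]
      have : v2 ((‖v2 z‖)⁻¹ • z) = (‖v2 z‖)⁻¹ • v2 z := rfl
      rw [this, norm_smul, norm_inv, norm_norm, inv_mul_cancel₀ h0.ne', one_pow]
    have h3 : r ≤ ‖v2 (A.mulVec ((‖v2 z‖)⁻¹ • z))‖ :=
      le_sq_aux (h1.trans h2) (norm_nonneg _)
    have h4 : v2 (A.mulVec ((‖v2 z‖)⁻¹ • z)) = (‖v2 z‖)⁻¹ • v2 (A.mulVec z) := by
      rw [Matrix.mulVec_smul]; rfl
    rw [h4, norm_smul, norm_inv, norm_norm, le_inv_mul_iff₀ h0] at h3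
    linarith

lemma dual_le {m N : ℕ} (y : Fin m → ℝ) (A : Matrix (Fin m) (Fin N) ℝ)
    (x : Fin N → ℝ) (j : Fin N) (hj : j ∉ supp x) : |gr y A x j| ≤ dualInfNorm y A x := by
  refine le_csSup ?_ ⟨j, hj, rfl⟩
  refine Set.Finite.bddAbove ((Set.finite_range fun j => |gr y A x j|).subset ?_)
  rintro v ⟨j, _, rfl⟩
  exact ⟨j, rfl⟩

/-- The quantitative stability statement. -/
lemma main_stab {m N : ℕ} (lam : ℝ) (hlam : 0 < lam)
    (y y' : Fin m → ℝ) (A A' : Matrix (Fin m) (Fin N) ℝ) (x x' : Fin N → ℝ)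
    (hx : x ∈ Sol lam y A) (hx' : x' ∈ Sol lam y' A') (s α d : ℝ) (hs : 0 < s) (hα : 1 ≤ α)
    (hd0 : 0 ≤ d) (hdα : d ≤ α)
    (hT : ∀ u, ‖TL A u‖ ≤ α * ‖u‖) (hTT : ∀ u, ‖TL A' u - TL A u‖ ≤ d * ‖u‖)
    (hy : ‖v2 y‖ ≤ α) (hyy : ‖v2 y' - v2 y‖ ≤ d)
    (h1 : s ≤ lam / 2 - dualInfNorm y A x)
    (h2 : ENNReal.ofReal s ≤ gramInvNormInv A (supp x) ^ 2)
    (h3 : ∀ i, x i ≠ 0 → s ≤ |x i|)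
    (hq : d * qpoly N lam α s < s ^ 2) (hd1 : d ≤ Real.sqrt s / (6 * α)) :
    supp x = supp x' := by
  classical
  have hα0 : 0 < α := by linarith
  set S := supp x with hS
  have hxS : ∀ j, j ∉ S → x j = 0 := fun j hj => by
    by_contra h; exact hj h
  -- the restricted problem
  let B : Matrix (Fin m) (Fin N) ℝ := fun i j => if j ∈ S then A' i j else 0
  obtain ⟨w, hw⟩ := sol_nonempty lam hlam y' B
  have hwS : ∀ j, j ∉ S → w j = 0 := fun j hj => by
    have h := VIc hlam hw j 0
    have hg : gr y' B w j = 0 := by simp [gr, B, hj]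
    rw [hg] at h
    simp only [mul_zero, abs_zero, zero_add, zero_sub] at h
    by_contra hc
    have := abs_pos.2 hc
    nlinarith
  have hBA : ∀ z : Fin N → ℝ, (∀ j, j ∉ S → z j = 0) → B.mulVec z = A'.mulVec z := fun z hz => by
    funext i
    simp only [Matrix.mulVec, dotProduct]
    refine Finset.sum_congr rfl fun j _ => ?_
    by_cases hj : j ∈ S
    · simp [B, hj]
    · simp [hz j hj]
  have hgr : ∀ j ∈ S, gr y' B w j = gr y' A' w j := fun j hj => by
    simp only [gr, hBA w hwS, B, if_pos hj]
  have hwVI : ∀ j ∈ S, ∀ t, 0 ≤ 2 * ((t - w j) * gr y' A' w j) + lam * (|t| - |w j|) :=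
    fun j hj t => by
      rw [← hgr j hj]; exact VIc hlam hw j t
  have hxw : ∀ j, j ∉ S → (x - w) j = 0 := fun j hj => by simp [hxS j hj, hwS j hj]
  have hwx : ∀ j, j ∉ S → (w - x) j = 0 := fun j hj => by simp [hxS j hj, hwS j hj]
  have hadd : v2 x + v2 (w - x) = v2 w := by
    rw [← WithLp.toLp_add]; congr 1; abel
  have hinner : inner ℝ (TL A' (v2 x + v2 (w - x)) - v2 y') (TL A' (v2 (w - x))) ≤
      inner ℝ (TL A (v2 x) - v2 y) (TL A (v2 (w - x))) := by
    have a1 := VI hlam hx w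
    have a2 := VI hlam hw x
    have a3 : TL B (v2 (x - w)) = - TL A' (v2 (w - x)) := by
      rw [TL_v2, hBA _ hxw, ← TL_v2, ← map_neg]; congr 1
      rw [← WithLp.toLp_neg]; congr 1; abel
    have a4 : TL B (v2 w) = TL A' (v2 w) := by rw [TL_v2, hBA _ hwS, TL_v2]
    rw [a3, a4, inner_neg_right] at a2
    rw [hadd]
    linarith
  have hres : ‖TL A (v2 x) - v2 y‖ ≤ α := by
    have h := hx 0
    rw [obj_eq, obj_eq] at h
    have e0 : v2 (0 : Fin N → ℝ) = 0 := rfl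
    rw [e0, map_zero, zero_sub, norm_neg] at h
    have : 0 ≤ ∑ j, |x j| := Finset.sum_nonneg fun _ _ => abs_nonneg _
    have h' : ‖TL A (v2 x) - v2 y‖ ^ 2 ≤ ‖v2 y‖ ^ 2 := by
      simp only [Pi.zero_apply, abs_zero, Finset.sum_const_zero, mul_zero, add_zero] at h
      nlinarith
    exact (le_sq_aux h' (norm_nonneg _)).trans hy
  have hgj : ∀ (C : Matrix (Fin m) (Fin N) ℝ) (b : Fin m → ℝ) (z : Fin N → ℝ) (j : Fin N),
      inner ℝ (TL C (v2 z) - v2 b) (TL C (v2 (Pi.single j 1))) = gr b C z j := fun C b z j => by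
    rw [inner_gr, Finset.sum_eq_single j]
    · simp
    · intro k _ hk; simp [hk]
    · simp
  have hej : ∀ j : Fin N, ‖v2 (Pi.single j 1 : Fin N → ℝ)‖ ≤ 1 := fun j => by
    apply le_sq_aux _ zero_le_one
    rw [l2_sq]; simp [Pi.single_apply]
  have hsN : 0 ≤ Real.sqrt N := Real.sqrt_nonneg _
  have hss : 0 ≤ Real.sqrt s := Real.sqrt_nonneg _
  -- conclusion of the analysis
  have hmain : (∀ j ∈ S, w j ≠ 0) ∧ (∀ j, |gr y' A' w j - gr y A x j| < s) ∧
      (∀ z : Fin N → ℝ, (∀ j, j ∉ S → z j = 0) → ‖v2 (A'.mulVec z)‖ = 0 → ‖v2 z‖ = 0) := by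
    by_cases hSe : S = ∅
    · have hx0 : x = 0 := by funext j; exact hxS j (by rw [hSe]; exact fun h => h)
      have hw0 : w = 0 := by funext j; exact hwS j (by rw [hSe]; exact fun h => h)
      refine ⟨fun j hj => ?_, fun j => ?_, fun z hz _ => ?_⟩
      · rw [hSe] at hj; exact absurd hj (fun h => h)
      · rw [← hgj, ← hgj, hx0, hw0]
        have e0 : v2 (0 : Fin N → ℝ) = 0 := rfl
        rw [e0]
        refine core0 (TL A) (TL A') (v2 y) (v2 y') α d s hα hd0 hdα ?_ hT hTT hy hyy _ (hej j)
        have : s * (3 * α) ≤ qpoly N lam α s := by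
          unfold qpoly
          have p1 : 0 ≤ 96 * α ^ 5 := by positivity
          have p2 : 0 ≤ 12 * α ^ 3 * (1 + lam * Real.sqrt N) * Real.sqrt s := by positivity
          have p3 : 0 ≤ s * (2 * α ^ 3 / lam) := by positivity
          linarith
        have h5 := mul_le_mul_of_nonneg_left this hd0
        have : s * (3 * α * d) < s * s := by nlinarith
        exact lt_of_mul_lt_mul_left this hs.le
      · have hz0 : z = 0 := by funext j; exact hz j (by rw [hSe]; exact fun h => h)
        rw [hz0]; simp
    · set r := Real.sqrt (Real.sqrt s) with hr
      have hr0 : 0 < r := Real.sqrt_pos.2 (Real.sqrt_pos.2 hs)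
      have hr2 : r ^ 2 = Real.sqrt s := Real.sq_sqrt hss
      have hr4 : r ^ 4 = s := by
        rw [show r ^ 4 = (r ^ 2) ^ 2 by ring, hr2, Real.sq_sqrt hs.le]
      have hr8 : r ^ 8 = s ^ 2 := by rw [← hr4]; ring
      have hgram := gram_le A S hSe r hr0 (by rw [hr4]; exact h2)
      have hxpos : 0 < ‖v2 x‖ := by
        rw [norm_pos_iff]
        intro h0
        apply hSe
        ext j
        have : x j = 0 := congrArg (fun v : EuclideanSpace ℝ (Fin N) => v j) h0
        simp [hS, supp, this]
      have hrα : r ≤ α := by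
        have := (hgram x hxS).trans (hT (v2 x))
        exact le_of_mul_le_mul_right this hxpos
      have hq96 : d * (96 * α ^ 5) < r ^ 8 := by
        rw [hr8]
        refine lt_of_le_of_lt (mul_le_mul_of_nonneg_left ?_ hd0) hq
        unfold qpoly
        have p2 : 0 ≤ 12 * α ^ 3 * (1 + lam * Real.sqrt N) * Real.sqrt s := by positivity
        have p3 : 0 ≤ s * (2 * α ^ 3 / lam + 3 * α) := by positivity
        linarith
      obtain ⟨c1, c2⟩ := core_s10 (TL A) (TL A') (v2 x) (v2 (w - x)) (v2 y) (v2 y') α d r hr0 hα hrα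
        hd0 (by rw [hr2]; exact hd1) hq96 hT hTT hy hyy hres (hgram x hxS) (hgram _ hwx) hinner
      rw [hr4] at c1 c2
      refine ⟨fun j hj hwj => ?_, fun j => ?_, fun z hz hz0 => ?_⟩
      · have a1 := h3 j hj
        have a2 : ‖(v2 (w - x)) j‖ ≤ ‖v2 (w - x)‖ := PiLp.norm_apply_le _ j
        have a3 : (v2 (w - x)) j = - x j := by simp [hwj]
        rw [a3, norm_neg, Real.norm_eq_abs] at a2
        linarith
      · have := c2 _ (hej j)
        rw [hadd, hgj, hgj] at this
        exact this
      · have a1 := hgram z hz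
        have a2 := hTT (v2 z)
        rw [TL_v2, TL_v2, norm_eq_zero.1 hz0, zero_sub, norm_neg] at a2
        have hdr : 6 * d ≤ r := by
          rw [← hr2, le_div_iff₀ (by positivity)] at hd1
          by_contra hc
          push Not at hc
          nlinarith
        by_contra hne
        have hpos : 0 < ‖v2 z‖ := lt_of_le_of_ne (norm_nonneg _) (Ne.symm hne)
        have : r ≤ d := le_of_mul_le_mul_right (a1.trans a2) hpos
        linarith
  obtain ⟨m1, m2, m3⟩ := hmain
  have hg : ∀ j, j ∉ S → |gr y' A' w j| < lam / 2 := fun j hj => by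
    have a1 := dual_le y A x j hj
    have a2 := m2 j
    have a3 := abs_add_le (gr y' A' w j - gr y A x j) (gr y A x j)
    rw [sub_add_cancel] at a3
    linarith
  obtain ⟨u1, u2⟩ := uniq S hwVI hwS hg hx'
  have hz := m3 (x' - w) (fun j hj => by simp [u1 j hj, hwS j hj]) u2
  have hxw' : x' = w := by
    have h0 := norm_eq_zero.1 hz
    funext j
    have : (x' - w) j = 0 := congrArg (fun v : EuclideanSpace ℝ (Fin N) => v j) h0
    exact sub_eq_zero.1 this
  ext j
  constructor
  · intro hj
    rw [hxw']; exact m1 j hj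
  · intro hj
    by_contra hc
    exact hj (u1 j hc)

/-- For every `(y,A)`, writing `α = ⦀(y,A)⦀₂` and `σ = σ(y,A)`,
`stsp(y,A) ≥ (mN)^{−1/2} · min{σ²/q(α,σ), √σ/(6α), α}`. -/
theorem stsp_lower_bound
    {m N : ℕ} (lam : ℝ) (hlam : 0 < lam)
    (y : Fin m → ℝ) (A : Matrix (Fin m) (Fin N) ℝ) :
    ((m : ℝ) * N) ^ (-(1 : ℝ) / 2) *
      min ((sigmaUL lam y A).toReal ^ 2 /
            qpoly N lam (trNorm2 y A) (sigmaUL lam y A).toReal)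
        (min (Real.sqrt (sigmaUL lam y A).toReal / (6 * trNorm2 y A)) (trNorm2 y A))
      ≤ stsp lam y A := by
  have hset0 : 0 ≤ stsp lam y A := Real.sInf_nonneg fun δ hδ => hδ.1
  rcases Nat.eq_zero_or_pos m with hm | hm
  · subst hm
    rw [Nat.cast_zero, zero_mul, Real.zero_rpow (by norm_num), zero_mul]
    exact hset0
  rcases Nat.eq_zero_or_pos N with hN | hN
  · subst hN
    rw [Nat.cast_zero, mul_zero, Real.zero_rpow (by norm_num), zero_mul]
    exact hset0
  have hm' : (0 : ℝ) < m := by exact_mod_cast hm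
  have hN' : (0 : ℝ) < N := by exact_mod_cast hN
  have hmN : 0 < (m : ℝ) * N := mul_pos hm' hN'
  have hpow : ((m : ℝ) * N) ^ (-(1 : ℝ) / 2) = (Real.sqrt (m * N))⁻¹ := by
    rw [Real.sqrt_eq_rpow, ← Real.rpow_neg hmN.le]; norm_num
  have hsq : 0 < Real.sqrt ((m : ℝ) * N) := Real.sqrt_pos.2 hmN
  set α := trNorm2 y A with hαdef
  set s := (sigmaUL lam y A).toReal with hsdef
  have hα : 1 ≤ α := (le_max_right _ _).trans (le_max_right _ _)
  have hα0 : 0 < α := by linarith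
  have hyα : ‖v2 y‖ ≤ α := by
    rw [← l2_eq]; exact (le_max_left _ _).trans (le_max_right _ _)
  have hT : ∀ u, ‖TL A u‖ ≤ α * ‖u‖ := fun u =>
    (spec_bound A u.ofLp).trans (mul_le_mul_of_nonneg_right (le_max_left _ _) (norm_nonneg _))
  have hs0 : 0 ≤ s := ENNReal.toReal_nonneg
  rcases hs0.eq_or_lt with hs | hs
  · refine le_trans (mul_nonpos_of_nonneg_of_nonpos (by positivity) (min_le_of_left_le ?_)) hset0
    rw [← hs]; simp
  rw [hpow]
  refine le_csInf (set_nonempty hm hN lam hlam y A) ?_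
  rintro δ ⟨hδ, y', A', x, x', hx, hx', hyd, hAd, hne⟩
  rw [inv_mul_le_iff₀ hsq]
  by_contra hc
  push Not at hc
  apply hne
  rw [lt_min_iff, lt_min_iff] at hc
  obtain ⟨c1, c2, c3⟩ := hc
  rw [mul_comm] at c1 c2 c3
  have hqpos : 0 < qpoly N lam α s := by
    unfold qpoly
    have p1 : 0 < 96 * α ^ 5 := by positivity
    have p2 : 0 ≤ 12 * α ^ 3 * (1 + lam * Real.sqrt N) * Real.sqrt s := by positivity
    have p3 : 0 ≤ s * (2 * α ^ 3 / lam + 3 * α) := by positivity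
    linarith
  have hofs : ENNReal.ofReal s ≤ sigmaUL lam y A := ENNReal.ofReal_toReal_le
  refine main_stab lam hlam y y' A A' x x' hx hx' s α (δ * Real.sqrt (m * N)) hs hα
    (by positivity) c3.le hT (fun u => ?_) hyα ?_ ?_ ?_ (fun i hi => ?_)
    ((lt_div_iff₀ hqpos).1 c1) c2.le
  · have := frob (A' - A) δ hδ (fun i j => hAd i j) u.ofLp
    rw [Matrix.sub_mulVec] at this
    exact this
  · exact vecb hN (y' - y) δ hδ hyd
  · have h1 : ENNReal.ofReal s ≤ ENNReal.ofReal (lam / 2 - dualInfNorm y A x) :=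
      (hofs.trans (min_le_left _ _)).trans (sInf_le ⟨x, hx, rfl⟩)
    by_contra hlt
    push Not at hlt
    exact absurd h1 (not_le.2 ((ENNReal.ofReal_lt_ofReal_iff hs).2 hlt))
  · refine (hofs.trans ((min_le_right _ _).trans (min_le_left _ _))).trans ?_
    exact pow_le_pow_left' (show sigma2 lam y A ≤ _ from sInf_le ⟨x, hx, rfl⟩) 2
  · have h1 : ENNReal.ofReal s ≤ ENNReal.ofReal |x i| :=
      (hofs.trans ((min_le_right _ _).trans (min_le_right _ _))).trans
        (sInf_le ⟨i, x, hx, hi, rfl⟩)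
    exact (ENNReal.ofReal_le_ofReal_iff (abs_nonneg _)).1 h1
end
end
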